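/- Let A : ℝ^{n×n} → ℝ^{2m} be a linear map of the form A(X)_j = ⟨A_j, X⟩ for fixed matrices A_1, …, A_{2m}, and define B : ℝ^{n×n} → ℝ^m by B(X)_i := A(X)_{2i−1} − A(X)_{2i}. Let γ^{lb}_s, γ^{ub}_s denote the RIP-ℓ2/ℓ1 constants of B over s-sparse matrices. Let Σ ∈ ℝ^{n×n} be positive semidefinite, write Σ = Σ_{Ω_0} + Σ_{Ω_0^c} where Σ_{Ω_0} is a best k-sparse approximation of Σ, let η ∈ ℝ^{2m} satisfy ‖η‖_1 ≤ ε1, and set y := A(Σ) + η. Suppose Σ̂ minimizes ‖M‖_1 over all positive semidefinite M with ‖y − A(M)‖_1 ≤ ε1. If there exist a number K2 > 2k and β2 > 0 such that (1 − γ^{lb}_{k+K2})/√2 − (1 + γ^{ub}_{K2})·√(k/K2) ≥ β2, then ‖Σ̂ − Σ‖_F ≤ (1 + √(k/K2))·(2/β2)·[ (1 + γ^{ub}_{K2})·‖Σ_{Ω_0^c}‖_1/√K2 + ε1/m ] + 2·‖Σ_{Ω_0^c}‖_1/√K2. -/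

import Mathlib

open Matrix

noncomputable section

/-- Frobenius norm of a real square matrix. -/
def frobNorm {n : ℕ} (X : Matrix (Fin n) (Fin n) ℝ) : ℝ :=
  Real.sqrt (∑ i, ∑ j, X i j ^ 2)

/-- Frobenius inner product `⟨Y, X⟩ = trace (Yᵀ X)`. -/
def finner {n : ℕ} (Y X : Matrix (Fin n) (Fin n) ℝ) : ℝ := ∑ i, ∑ j, Y i j * X i j

/-- Entrywise ℓ¹ norm of a matrix. -/
def matL1 {n : ℕ} (X : Matrix (Fin n) (Fin n) ℝ) : ℝ := ∑ i, ∑ j, |X i j|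

/-- ℓ¹ norm of a vector. -/
def vecL1 {m : ℕ} (v : Fin m → ℝ) : ℝ := ∑ i, |v i|

/-- Number of nonzero entries of a matrix. -/
def sparsity {n : ℕ} (X : Matrix (Fin n) (Fin n) ℝ) : ℕ :=
  {p : Fin n × Fin n | X p.1 p.2 ≠ 0}.ncard

/-- The linear map `X ↦ (⟨A_j, X⟩)_j`. -/
def measOf {n m : ℕ} (A : Fin m → Matrix (Fin n) (Fin n) ℝ)
    (X : Matrix (Fin n) (Fin n) ℝ) : Fin m → ℝ := fun j => finner (A j) X

/-- The debiased operator `B(X) i = A(X)_{2i-1} − A(X)_{2i}` (with `0`-based indexing). -/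
def debiasedOf {n m : ℕ} (A : Fin (2 * m) → Matrix (Fin n) (Fin n) ℝ)
    (X : Matrix (Fin n) (Fin n) ℝ) : Fin m → ℝ := fun i =>
  measOf A X ⟨2 * i.1, by have := i.2; omega⟩ - measOf A X ⟨2 * i.1 + 1, by have := i.2; omega⟩

/-- `SΩ` is the best `k`-sparse approximation of `S`: it keeps `k` entries of largest
magnitude of `S` and zeroes out the rest. -/
def IsBestKSparseTrunc {n : ℕ} (k : ℕ) (S SΩ : Matrix (Fin n) (Fin n) ℝ) : Prop :=
  ∃ s : Finset (Fin n × Fin n), s.card ≤ k ∧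
    (∀ p : Fin n × Fin n, SΩ p.1 p.2 = if p ∈ s then S p.1 p.2 else 0) ∧
    ∀ p ∈ s, ∀ q : Fin n × Fin n, q ∉ s → |S q.1 q.2| ≤ |S p.1 p.2|

lemma exists_top {ι : Type*} [DecidableEq ι] (f : ι → ℝ) (T : Finset ι) (K : ℕ)
    (hK : K ≤ T.card) :
    ∃ T1 ⊆ T, T1.card = K ∧ ∀ p ∈ T1, ∀ q ∈ T \ T1, |f q| ≤ |f p| := by
  induction K with
  | zero => exact ⟨∅, by simp, by simp, by simp⟩
  | succ K ih =>
    obtain ⟨T1, h1, h2, h3⟩ := ih (by omega)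
    have hne : (T \ T1).Nonempty := by
      rw [← Finset.card_pos, Finset.card_sdiff_of_subset h1]; omega
    obtain ⟨x, hx, hmax⟩ := Finset.exists_max_image (T \ T1) (fun p => |f p|) hne
    have hx' := Finset.mem_sdiff.1 hx
    refine ⟨insert x T1, Finset.insert_subset hx'.1 h1, ?_, ?_⟩
    · rw [Finset.card_insert_of_notMem hx'.2, h2]
    · intro p hp q hq
      have hq' : q ∈ T \ T1 := by
        simp only [Finset.mem_sdiff, Finset.mem_insert, not_or] at hq ⊢
        exact ⟨hq.1, hq.2.2⟩
      rcases Finset.mem_insert.1 hp with rfl | hp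
      · exact hmax q hq'
      · exact h3 p hp q hq'

/-- l2 norm of the restriction -/
def nrm {ι : Type*} (f : ι → ℝ) (T : Finset ι) : ℝ := Real.sqrt (∑ p ∈ T, f p ^ 2)

lemma nrm_nonneg {ι : Type*} (f : ι → ℝ) (T : Finset ι) : 0 ≤ nrm f T := Real.sqrt_nonneg _

lemma nrm_sq {ι : Type*} (f : ι → ℝ) (T : Finset ι) : nrm f T ^ 2 = ∑ p ∈ T, f p ^ 2 :=
  Real.sq_sqrt (Finset.sum_nonneg fun _ _ => sq_nonneg _)

lemma nrm_mono {ι : Type*} (f : ι → ℝ) {T U : Finset ι} (h : T ⊆ U) : nrm f T ≤ nrm f U :=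
  Real.sqrt_le_sqrt (Finset.sum_le_sum_of_subset_of_nonneg h fun _ _ _ => sq_nonneg _)

lemma nrm_union {ι : Type*} [DecidableEq ι] (f : ι → ℝ) (T U : Finset ι) (h : Disjoint T U) :
    nrm f (T ∪ U) ≤ nrm f T + nrm f U := by
  apply Real.sqrt_le_iff.2
  have h1 := nrm_nonneg f T
  have h2 := nrm_nonneg f U
  refine ⟨by positivity, ?_⟩
  rw [Finset.sum_union h, ← nrm_sq, ← nrm_sq]
  nlinarith

lemma l1_le_nrm {ι : Type*} (f : ι → ℝ) (T : Finset ι) :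
    ∑ p ∈ T, |f p| ≤ Real.sqrt T.card * nrm f T := by
  rw [nrm, ← Real.sqrt_mul (by positivity)]
  apply Real.le_sqrt_of_sq_le
  have := sq_sum_le_card_mul_sum_sq (s := T) (f := fun p => |f p|)
  simpa using this

lemma nrm_block {ι : Type*} (f : ι → ℝ) (T U : Finset ι) (K : ℕ) (hK : 0 < K)
    (hT : T.card = K) (hU : U.card ≤ K) (h : ∀ p ∈ T, ∀ q ∈ U, |f q| ≤ |f p|) :
    nrm f U ≤ (∑ p ∈ T, |f p|) / Real.sqrt K := by
  have hK' : (0:ℝ) < K := by exact_mod_cast hK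
  set a := ∑ p ∈ T, |f p| with ha
  have ha0 : 0 ≤ a := Finset.sum_nonneg fun _ _ => abs_nonneg _
  have hq : ∀ q ∈ U, |f q| ≤ a / K := by
    intro q hq
    rw [le_div_iff₀ hK']
    have := Finset.card_nsmul_le_sum T (fun p => |f p|) |f q| (fun p hp => h p hp q hq)
    rw [hT, nsmul_eq_mul] at this
    linarith
  apply Real.sqrt_le_iff.2
  refine ⟨by positivity, ?_⟩
  have : ∑ q ∈ U, f q ^ 2 ≤ U.card • (a / K) ^ 2 := by
    apply Finset.sum_le_card_nsmul
    intro q hqU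
    rw [← sq_abs]
    exact pow_le_pow_left₀ (abs_nonneg _) (hq q hqU) 2
  rw [nsmul_eq_mul] at this
  have h2 : (U.card : ℝ) * (a / K) ^ 2 ≤ K * (a / K) ^ 2 := by
    apply mul_le_mul_of_nonneg_right (by exact_mod_cast hU) (sq_nonneg _)
  have h3 : (K:ℝ) * (a / K) ^ 2 = (a / Real.sqrt K) ^ 2 := by
    rw [div_pow, div_pow, Real.sq_sqrt hK'.le]; field_simp
  linarith

lemma shelling {ι : Type*} [DecidableEq ι] (f : ι → ℝ) (K : ℕ) (hK : 0 < K)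
    (g : Finset ι → ℝ) (c : ℝ) (hc : 0 ≤ c)
    (hg : ∀ T U, Disjoint T U → g (T ∪ U) ≤ g T + g U)
    (hgc : ∀ T : Finset ι, T.card ≤ K → g T ≤ c * nrm f T) (N : ℕ) :
    ∀ T : Finset ι, T.card ≤ N → ∃ T1 ⊆ T, T1.card ≤ K ∧
      (K ≤ T.card → T1.card = K ∧ ∀ p ∈ T1, ∀ q ∈ T \ T1, |f q| ≤ |f p|) ∧ ∃ R : ℝ,
      nrm f (T \ T1) ≤ R ∧ g (T \ T1) ≤ c * R ∧ R ≤ (∑ p ∈ T, |f p|) / Real.sqrt K := by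
  have base : ∀ T : Finset ι, T.card ≤ K → ∃ T1 ⊆ T, T1.card ≤ K ∧
      (K ≤ T.card → T1.card = K ∧ ∀ p ∈ T1, ∀ q ∈ T \ T1, |f q| ≤ |f p|) ∧ ∃ R : ℝ,
      nrm f (T \ T1) ≤ R ∧ g (T \ T1) ≤ c * R ∧ R ≤ (∑ p ∈ T, |f p|) / Real.sqrt K := by
    intro T hT
    refine ⟨T, subset_rfl, hT, fun h => ⟨by omega, by simp⟩, 0, by simp [nrm], ?_, ?_⟩
    · have := hgc ∅ (by simp)
      simpa [nrm] using this
    · have : 0 ≤ ∑ p ∈ T, |f p| := Finset.sum_nonneg fun _ _ => abs_nonneg _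
      positivity
  induction N with
  | zero => intro T hT; exact base T (by omega)
  | succ N ih =>
    intro T hT
    by_cases hTK : T.card ≤ K
    · exact base T hTK
    obtain ⟨T1, h1, h2, h3⟩ := exists_top f T K (by omega)
    obtain ⟨T2, h4, h5, -, R, h6, h7, h8⟩ := ih (T \ T1) (by
      rw [Finset.card_sdiff_of_subset h1]; omega)
    have hb := nrm_block f T1 T2 K hK h2 h5 (fun p hp q hq => h3 p hp q (h4 hq))
    have hu : T \ T1 = T2 ∪ ((T \ T1) \ T2) := (Finset.union_sdiff_of_subset h4).symm
    refine ⟨T1, h1, h2.le, fun _ => ⟨h2, h3⟩, (∑ p ∈ T1, |f p|) / Real.sqrt K + R, ?_, ?_, ?_⟩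
    · rw [hu]
      exact (nrm_union f _ _ Finset.disjoint_sdiff).trans (add_le_add hb h6)
    · rw [hu]
      refine (hg _ _ Finset.disjoint_sdiff).trans ?_
      rw [mul_add]
      exact add_le_add ((hgc _ h5).trans (mul_le_mul_of_nonneg_left hb hc)) h7
    · rw [← Finset.sum_sdiff h1, add_div]
      linarith

/-- restriction of a matrix to a set of entries -/
def restr {n : ℕ} (H : Matrix (Fin n) (Fin n) ℝ) (T : Finset (Fin n × Fin n)) :
    Matrix (Fin n) (Fin n) ℝ := fun i j => if (i, j) ∈ T then H i j else 0

lemma frob_restr {n : ℕ} (H : Matrix (Fin n) (Fin n) ℝ) (T : Finset (Fin n × Fin n)) :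
    frobNorm (restr H T) = nrm (fun p => H p.1 p.2) T := by
  unfold frobNorm nrm restr
  congr 1
  rw [← Fintype.sum_prod_type' (fun i j => (if (i, j) ∈ T then H i j else 0) ^ 2)]
  simp [ite_pow, Finset.sum_ite_mem]

lemma restr_univ {n : ℕ} (H : Matrix (Fin n) (Fin n) ℝ) : restr H Finset.univ = H := by
  ext i j; simp [restr]

lemma restr_union {n : ℕ} (H : Matrix (Fin n) (Fin n) ℝ) (T U : Finset (Fin n × Fin n))
    (h : Disjoint T U) : restr H (T ∪ U) = restr H T + restr H U := by
  ext i j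
  have := @Finset.disjoint_left _ T U
  by_cases h1 : (i, j) ∈ T
  · have h2 := this.1 h h1
    simp [restr, h1, h2]
  · simp [restr, h1]

lemma sparsity_restr {n : ℕ} (H : Matrix (Fin n) (Fin n) ℝ) (T : Finset (Fin n × Fin n)) :
    sparsity (restr H T) ≤ T.card := by
  unfold sparsity
  rw [← Set.ncard_coe_finset]
  apply Set.ncard_le_ncard _ (Finset.finite_toSet T)
  intro p hp
  by_contra hn
  apply hp
  simp only [Finset.mem_coe] at hn
  simp [restr, hn]

lemma measOf_add {n m : ℕ} (A : Fin m → Matrix (Fin n) (Fin n) ℝ)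
    (X Y : Matrix (Fin n) (Fin n) ℝ) (j : Fin m) :
    measOf A (X + Y) j = measOf A X j + measOf A Y j := by
  simp [measOf, finner, mul_add, Finset.sum_add_distrib]

lemma measOf_sub {n m : ℕ} (A : Fin m → Matrix (Fin n) (Fin n) ℝ)
    (X Y : Matrix (Fin n) (Fin n) ℝ) (j : Fin m) :
    measOf A (X - Y) j = measOf A X j - measOf A Y j := by
  simp [measOf, finner, mul_sub, Finset.sum_sub_distrib]

lemma vecL1_add {n m : ℕ} (A : Fin (2 * m) → Matrix (Fin n) (Fin n) ℝ)
    (X Y : Matrix (Fin n) (Fin n) ℝ) :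
    vecL1 (debiasedOf A (X + Y)) ≤ vecL1 (debiasedOf A X) + vecL1 (debiasedOf A Y) := by
  unfold vecL1
  rw [← Finset.sum_add_distrib]
  apply Finset.sum_le_sum
  intro i _
  simp only [debiasedOf, measOf_add]
  refine le_trans (le_of_eq ?_) (abs_add_le _ _)
  congr 1; ring

lemma sum_two_mul (m : ℕ) (v : Fin (2 * m) → ℝ) :
    ∑ i : Fin m, (v ⟨2 * i.1, by have := i.2; omega⟩ + v ⟨2 * i.1 + 1, by have := i.2; omega⟩)
      = ∑ j, v j := by
  induction m with
  | zero => simp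
  | succ m ih =>
    rw [Fin.sum_univ_castSucc]
    have e : ∑ j, v j = ∑ j : Fin (2 * m + 1 + 1), v ⟨j.1, by have := j.2; omega⟩ := rfl
    rw [e, Fin.sum_univ_castSucc, Fin.sum_univ_castSucc]
    have := ih (fun j => v ⟨j.1, by have := j.2; omega⟩)
    simp only [Fin.val_castSucc, Fin.val_last] at this ⊢
    rw [this]; ring

lemma vecL1_debiased_le {n m : ℕ} (A : Fin (2 * m) → Matrix (Fin n) (Fin n) ℝ)
    (X : Matrix (Fin n) (Fin n) ℝ) : vecL1 (debiasedOf A X) ≤ vecL1 (measOf A X) := by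
  unfold vecL1
  rw [← sum_two_mul m]
  apply Finset.sum_le_sum
  intro i _
  exact abs_sub _ _

lemma matL1_eq {n : ℕ} (X : Matrix (Fin n) (Fin n) ℝ) : matL1 X = ∑ p : Fin n × Fin n, |X p.1 p.2| := by
  rw [matL1, ← Fintype.sum_prod_type' (fun i j => |X i j|)]

lemma cone {n : ℕ} (S SΩ Shat : Matrix (Fin n) (Fin n) ℝ) (s : Finset (Fin n × Fin n))
    (h : ∀ p : Fin n × Fin n, SΩ p.1 p.2 = if p ∈ s then S p.1 p.2 else 0)
    (hle : matL1 Shat ≤ matL1 S) :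
    ∑ p ∈ sᶜ, |(Shat - S) p.1 p.2| ≤ ∑ p ∈ s, |(Shat - S) p.1 p.2| + 2 * matL1 (S - SΩ) := by
  rw [matL1_eq, matL1_eq, ← Finset.sum_add_sum_compl s, ← Finset.sum_add_sum_compl s] at hle
  have e : matL1 (S - SΩ) = ∑ p ∈ sᶜ, |S p.1 p.2| := by
    rw [matL1_eq, ← Finset.sum_add_sum_compl s, Finset.sum_eq_zero, zero_add]
    · apply Finset.sum_congr rfl
      intro p hp
      rw [Matrix.sub_apply, h, if_neg (Finset.mem_compl.1 hp), sub_zero]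
    · intro p hp
      rw [Matrix.sub_apply, h, if_pos hp]; simp
  rw [e]
  have h1 : ∑ p ∈ s, |S p.1 p.2| ≤ ∑ p ∈ s, |(Shat - S) p.1 p.2| + ∑ p ∈ s, |Shat p.1 p.2| := by
    rw [← Finset.sum_add_distrib]
    apply Finset.sum_le_sum
    intro p _
    rw [Matrix.sub_apply]
    have := abs_sub_abs_le_abs_sub (S p.1 p.2) (Shat p.1 p.2)
    rw [abs_sub_comm] at this
    linarith
  have h2 : ∑ p ∈ sᶜ, |(Shat - S) p.1 p.2| ≤ ∑ p ∈ sᶜ, |Shat p.1 p.2| + ∑ p ∈ sᶜ, |S p.1 p.2| := by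
    rw [← Finset.sum_add_distrib]
    apply Finset.sum_le_sum
    intro p _
    rw [Matrix.sub_apply]
    exact abs_sub _ _
  linarith

/-- **Lemma 2 (deterministic recovery of sparse matrices via RIP-ℓ₂/ℓ₁).** -/
theorem sparse_duality_lemma {n m k K2 : ℕ}
    (A : Fin (2 * m) → Matrix (Fin n) (Fin n) ℝ)
    (γlb γub : ℕ → ℝ)
    (hRIP : ∀ (s : ℕ) (X : Matrix (Fin n) (Fin n) ℝ), sparsity X ≤ s →
      (1 - γlb s) * frobNorm X ≤ (1 / (m : ℝ)) * vecL1 (debiasedOf A X) ∧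
      (1 / (m : ℝ)) * vecL1 (debiasedOf A X) ≤ (1 + γub s) * frobNorm X)
    (S SΩ Shat : Matrix (Fin n) (Fin n) ℝ) (ε1 : ℝ) (η : Fin (2 * m) → ℝ)
    (hS : S.PosSemidef) (hSΩ : IsBestKSparseTrunc k S SΩ)
    (hη : vecL1 η ≤ ε1)
    (hfeas1 : Shat.PosSemidef)
    (hfeas2 : vecL1 (fun j => (measOf A S j + η j) - measOf A Shat j) ≤ ε1)
    (hmin : ∀ M : Matrix (Fin n) (Fin n) ℝ, M.PosSemidef →
      vecL1 (fun j => (measOf A S j + η j) - measOf A M j) ≤ ε1 → matL1 Shat ≤ matL1 M)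
    (β2 : ℝ) (hK2 : 2 * k < K2) (hβ2 : 0 < β2)
    (hcond : β2 ≤ (1 - γlb (k + K2)) / Real.sqrt 2 -
      (1 + γub K2) * Real.sqrt ((k : ℝ) / (K2 : ℝ))) :
    frobNorm (Shat - S) ≤
      (1 + Real.sqrt ((k : ℝ) / (K2 : ℝ))) * (2 / β2) *
        ((1 + γub K2) * matL1 (S - SΩ) / Real.sqrt (K2 : ℝ) + ε1 / (m : ℝ)) +
      2 * matL1 (S - SΩ) / Real.sqrt (K2 : ℝ) := by
  have hε : 0 ≤ ε1 := le_trans (Finset.sum_nonneg fun _ _ => abs_nonneg _) hη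
  rcases Nat.eq_zero_or_pos n with rfl | hn
  · simp only [frobNorm, matL1, Finset.univ_eq_empty, Finset.sum_empty, Real.sqrt_zero]
    simp only [mul_zero, zero_div, zero_add, add_zero]
    positivity
  have hKpos : 0 < K2 := by omega
  have hK' : (0:ℝ) < K2 := by exact_mod_cast hKpos
  have hc : 0 ≤ 1 + γub K2 := by
    let p0 : Fin n × Fin n := (⟨0, hn⟩, ⟨0, hn⟩)
    let J : Matrix (Fin n) (Fin n) ℝ := fun _ _ => 1
    have h1 := (hRIP K2 (restr J {p0}) ((sparsity_restr J {p0}).trans (by simp; omega))).2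
    rw [frob_restr] at h1
    have h2 : nrm (fun p => J p.1 p.2) {p0} = 1 := by simp [nrm, J]
    rw [h2, mul_one] at h1
    refine le_trans (mul_nonneg (by positivity) ?_) h1
    exact Finset.sum_nonneg fun _ _ => abs_nonneg _
  obtain ⟨s, hs, hSs, -⟩ := hSΩ
  have hle : matL1 Shat ≤ matL1 S := hmin S hS (by simpa using hη)
  have hcone := cone S SΩ Shat s hSs hle
  set σ := matL1 (S - SΩ) with hσ
  have hσ0 : 0 ≤ σ := Finset.sum_nonneg fun _ _ => Finset.sum_nonneg fun _ _ => abs_nonneg _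
  set H := Shat - S with hH
  have hBH : vecL1 (debiasedOf A H) ≤ 2 * ε1 := by
    refine (vecL1_debiased_le A H).trans ?_
    have : vecL1 (measOf A H) ≤ vecL1 η + vecL1 (fun j => (measOf A S j + η j) - measOf A Shat j) := by
      unfold vecL1
      rw [← Finset.sum_add_distrib]
      apply Finset.sum_le_sum
      intro j _
      rw [hH, measOf_sub]
      refine le_trans (le_of_eq ?_) (abs_sub _ _)
      congr 1; ring
    linarith
  have hg : ∀ T U : Finset (Fin n × Fin n), Disjoint T U →
      (1 / (m:ℝ)) * vecL1 (debiasedOf A (restr H (T ∪ U))) ≤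
      (1 / (m:ℝ)) * vecL1 (debiasedOf A (restr H T)) +
      (1 / (m:ℝ)) * vecL1 (debiasedOf A (restr H U)) := by
    intro T U hTU
    rw [restr_union H T U hTU, ← mul_add]
    exact mul_le_mul_of_nonneg_left (vecL1_add A _ _) (by positivity)
  obtain ⟨T1, hT1, hT1c, -, R, hR1, hR2, hR3⟩ := shelling (fun p : Fin n × Fin n => H p.1 p.2) K2 hKpos
    (fun T => (1 / (m:ℝ)) * vecL1 (debiasedOf A (restr H T))) (1 + γub K2) hc hg
    (fun T hT => by
      have := (hRIP K2 (restr H T) ((sparsity_restr H T).trans hT)).2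
      rwa [frob_restr] at this) _ sᶜ le_rfl
  set f := fun p : Fin n × Fin n => H p.1 p.2 with hf
  have hlow := (hRIP (k + K2) (restr H (s ∪ T1)) ((sparsity_restr H _).trans
    ((Finset.card_union_le _ _).trans (by omega)))).1
  rw [frob_restr] at hlow
  have hdis : Disjoint (s ∪ T1) (sᶜ \ T1) := by
    rw [Finset.disjoint_left]; intro p; simp; tauto
  have huniv : (s ∪ T1) ∪ (sᶜ \ T1) = Finset.univ := by
    ext p; simp; tauto
  have hfrob : frobNorm H ≤ nrm f (s ∪ T1) + R := by
    have h1 := frob_restr H Finset.univ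
    rw [restr_univ, ← huniv] at h1
    rw [h1]
    exact (nrm_union f _ _ hdis).trans (by linarith)
  -- lower bound on B(H)
  have hdis2 : (1 / (m:ℝ)) * vecL1 (debiasedOf A (restr H (s ∪ T1))) ≤
      (1 / (m:ℝ)) * vecL1 (debiasedOf A H) +
      (1 / (m:ℝ)) * vecL1 (debiasedOf A (restr H (sᶜ \ T1))) := by
    rw [← mul_add]
    refine mul_le_mul_of_nonneg_left ?_ (by positivity)
    have e : H = restr H (s ∪ T1) + restr H (sᶜ \ T1) := by
      rw [← restr_union H _ _ hdis, huniv, restr_univ]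
    unfold vecL1
    rw [← Finset.sum_add_distrib]
    apply Finset.sum_le_sum
    intro i _
    conv_rhs => rw [e]
    have e2 : debiasedOf A (restr H (s ∪ T1) + restr H (sᶜ \ T1)) i =
        debiasedOf A (restr H (s ∪ T1)) i + debiasedOf A (restr H (sᶜ \ T1)) i := by
      simp only [debiasedOf, measOf_add]; ring
    rw [← e] at e2 ⊢
    rw [e2]
    have := abs_sub (debiasedOf A (restr H (s ∪ T1)) i + debiasedOf A (restr H (sᶜ \ T1)) i)
      (debiasedOf A (restr H (sᶜ \ T1)) i)
    simpa using this
  have hB2 : (1 / (m:ℝ)) * vecL1 (debiasedOf A H) ≤ 2 * (ε1 / m) := by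
    refine (mul_le_mul_of_nonneg_left hBH (by positivity)).trans (le_of_eq ?_)
    ring
  set x := nrm f (s ∪ T1) with hx
  have hx0 : 0 ≤ x := nrm_nonneg _ _
  set q := Real.sqrt ((k:ℝ) / K2) with hq
  have hq0 : 0 ≤ q := Real.sqrt_nonneg _
  have hRx : R ≤ q * x + 2 * (σ / Real.sqrt K2) := by
    refine hR3.trans ?_
    have h1 : ∑ p ∈ s, |f p| ≤ Real.sqrt k * x := by
      refine (l1_le_nrm f s).trans ?_
      apply mul_le_mul (Real.sqrt_le_sqrt (by exact_mod_cast hs))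
        (nrm_mono f Finset.subset_union_left) (nrm_nonneg _ _) (Real.sqrt_nonneg _)
    have h2 : q = Real.sqrt k / Real.sqrt K2 := Real.sqrt_div (by positivity) _
    have h3 : q * x + 2 * (σ / Real.sqrt K2) = (Real.sqrt k * x + 2 * σ) / Real.sqrt K2 := by
      rw [h2]; ring
    rw [h3]
    apply div_le_div_of_nonneg_right _ (Real.sqrt_nonneg _)
    linarith
  have hs2 : (1 - γlb (k + K2)) / Real.sqrt 2 ≤ 1 - γlb (k + K2) := by
    have h0 : 0 < (1 - γlb (k + K2)) / Real.sqrt 2 := by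
      have := mul_nonneg hc hq0
      linarith
    have h1 : 0 < Real.sqrt 2 := by positivity
    have h2 : 0 < 1 - γlb (k + K2) := by
      rwa [div_pos_iff_of_pos_right h1] at h0
    exact div_le_self h2.le (Real.one_le_sqrt.2 (by norm_num))
  have hcR := mul_le_mul_of_nonneg_left hRx hc
  set t := σ / Real.sqrt K2 with ht
  have ht0 : 0 ≤ t := by positivity
  have hmain : β2 * x ≤ 2 * ((1 + γub K2) * t + ε1 / m) := by
    have h1 : β2 * x ≤ ((1 - γlb (k + K2)) - (1 + γub K2) * q) * x :=
      mul_le_mul_of_nonneg_right (by linarith) hx0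
    linarith
  have hx1 : x ≤ 2 / β2 * ((1 + γub K2) * t + ε1 / m) := by
    rw [div_mul_eq_mul_div, le_div_iff₀ hβ2]; linarith
  have hfin := mul_le_mul_of_nonneg_left hx1 (by linarith : 0 ≤ 1 + q)
  rw [mul_div_assoc, mul_div_assoc, ← ht, mul_assoc]
  linarith
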